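/- arXiv:2412.19879 — 2 statements merged into one kernel-verified Lean document; each statement's English description precedes it below -/
import Mathlib

section
/- For all integers ℓ, n with 1 ≤ n ≤ ℓ, the integral ∫₀^π cos(4s) csc²(s) [y_{ℓ,n}(s)]² ds converges and equals (32n³ − 32nℓ² − 32nℓ + 16n + 8ℓ³ + 12ℓ² − 2ℓ − 3) / (2n(2ℓ−1)(2ℓ+3)). -/
open Set Real

/-- The Legendre polynomial `P_ℓ(x) = (1/(2^ℓ ℓ!)) (d/dx)^ℓ (x²−1)^ℓ`. -/
noncomputable def legendreP (l : ℕ) (x : ℝ) : ℝ :=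
  (1 / ((2 : ℝ) ^ l * (Nat.factorial l : ℝ))) * iteratedDeriv l (fun t => (t ^ 2 - 1) ^ l) x

/-- The associated Legendre function `P_ℓⁿ(x) = (1−x²)^{n/2} (d/dx)ⁿ P_ℓ(x)` for `0 ≤ n ≤ ℓ`. -/
noncomputable def assocLegendreP (l n : ℕ) (x : ℝ) : ℝ :=
  (1 - x ^ 2) ^ ((n : ℝ) / 2) * iteratedDeriv n (legendreP l) x

/-- The normalized eigenfunction
`y_{ℓ,n}(s) = √((1+2ℓ)(ℓ−n)!/(2(ℓ+n)!)) · √(sin s) · P_ℓⁿ(cos s)`. -/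
noncomputable def pageY (l n : ℕ) (s : ℝ) : ℝ :=
  Real.sqrt ((1 + 2 * (l : ℝ)) * (Nat.factorial (l - n) : ℝ) / (2 * (Nat.factorial (l + n) : ℝ))) *
    (Real.sqrt (Real.sin s) * assocLegendreP l n (Real.cos s))

open Polynomial in
/-- `(X²-1)^l` differentiated `k` times. -/
noncomputable def auxV (l k : ℕ) : ℝ[X] := derivative^[k] ((X ^ 2 - 1) ^ l)

open Polynomial in
noncomputable def auxW : ℝ[X] := 1 - X ^ 2

noncomputable def auxJ (p : Polynomial ℝ) : ℝ := ∫ x in (-1:ℝ)..1, p.eval x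

lemma auxJ_add (p q : Polynomial ℝ) : auxJ (p + q) = auxJ p + auxJ q := by
  simp only [auxJ, Polynomial.eval_add]
  exact intervalIntegral.integral_add (p.continuous.intervalIntegrable _ _)
    (q.continuous.intervalIntegrable _ _)

lemma auxJ_C (a : ℝ) (p : Polynomial ℝ) : auxJ (Polynomial.C a * p) = a * auxJ p := by
  simp [auxJ]

lemma auxJ_sub (p q : Polynomial ℝ) : auxJ (p - q) = auxJ p - auxJ q := by
  simp only [auxJ, Polynomial.eval_sub]
  exact intervalIntegral.integral_sub (p.continuous.intervalIntegrable _ _)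
    (q.continuous.intervalIntegrable _ _)

lemma auxJ_der (p : Polynomial ℝ) : auxJ (Polynomial.derivative (auxW * p)) = 0 := by
  unfold auxJ
  rw [intervalIntegral.integral_eq_sub_of_hasDerivAt
    (fun x _ => (auxW * p).hasDerivAt x)
    ((Polynomial.derivative (auxW * p)).continuous.intervalIntegrable _ _)]
  simp [auxW]

lemma auxV_succ (l k : ℕ) : Polynomial.derivative (auxV l k) = auxV l (k+1) := by
  simp [auxV, Function.iterate_succ_apply']

open Polynomial in
lemma C2 : (C (2:ℝ)) = (2:ℝ[X]) := rfl
open Polynomial in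
lemma C3 : (C (3:ℝ)) = (3:ℝ[X]) := rfl
open Polynomial in
lemma C4 : (C (4:ℝ)) = (4:ℝ[X]) := rfl

open Polynomial in
lemma auxV_ode0 (l : ℕ) : (X ^ 2 - 1) * auxV l 1 = C (2 * (l:ℝ)) * X * auxV l 0 := by
  cases l with
  | zero => simp [auxV]
  | succ l =>
    simp only [auxV, Function.iterate_one, Function.iterate_zero, id]
    simp [derivative_pow]
    ring

open Polynomial in
lemma auxV_ode1 (l k : ℕ) : (X ^ 2 - 1) * auxV l (k+2) + 2 * ((k:ℝ[X]) + 1 - (l:ℝ[X])) * X * auxV l (k+1)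
    + ((k:ℝ[X])+1) * ((k:ℝ[X]) - 2 * (l:ℝ[X])) * auxV l k = 0 := by
  induction k with
  | zero =>
    have h := congrArg derivative (auxV_ode0 l)
    simp [auxV_succ, C2] at h
    simp
    linear_combination h
  | succ k ih =>
    have h := congrArg derivative ih
    simp [auxV_succ] at h
    push_cast
    linear_combination h

open Polynomial in
lemma auxV_top (l : ℕ) : auxV l (l + l) = Polynomial.C ((Nat.factorial (2 * l) : ℕ) : ℝ) := by
  unfold auxV
  have hd : ((X ^ 2 - 1 : ℝ[X]) ^ l).natDegree = 2 * l := by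
    rw [natDegree_pow, show (X ^ 2 - 1 : ℝ[X]) = X ^ 2 - C 1 by simp, natDegree_X_pow_sub_C, mul_comm]
  have hm : ((X ^ 2 - 1 : ℝ[X]) ^ l).Monic := by
    rw [show (X ^ 2 - 1 : ℝ[X]) = X ^ 2 - C 1 by simp]
    exact (monic_X_pow_sub_C 1 (by norm_num)).pow l
  have h0 : (derivative^[l + l] ((X ^ 2 - 1 : ℝ[X]) ^ l)).natDegree ≤ 0 := by
    refine (natDegree_iterate_derivative _ _).trans ?_
    omega
  rw [eq_C_of_natDegree_le_zero h0, coeff_iterate_derivative, ← two_mul, zero_add, Nat.descFactorial_self]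
  have : ((X ^ 2 - 1 : ℝ[X]) ^ l).coeff (2 * l) = 1 := by
    rw [← hd]; exact hm
  rw [this]; simp

/-- `U n` is proportional to the `n`-th derivative of the Legendre polynomial. -/
noncomputable def auxU (l n : ℕ) : Polynomial ℝ := auxV l (l + n)

lemma auxU_succ (l k : ℕ) : Polynomial.derivative (auxU l k) = auxU l (k+1) := by
  simp [auxU, auxV_succ, add_assoc]

open Polynomial in
lemma auxU_ode (l n : ℕ) : auxW * auxU l (n+2) - 2 * ((n:ℝ[X]) + 1) * X * auxU l (n+1)
    + ((l:ℝ[X]) - (n:ℝ[X])) * ((l:ℝ[X]) + (n:ℝ[X]) + 1) * auxU l n = 0 := by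
  have h := auxV_ode1 l (l + n)
  simp only [auxU, auxW]
  push_cast at h
  simp only [← add_assoc]
  linear_combination -h

noncomputable def auxA (l n : ℕ) : ℝ := auxJ (auxW ^ n * auxU l n ^ 2)
noncomputable def auxD (l n : ℕ) : ℝ := auxJ (auxW ^ n * auxU l (n+1) ^ 2)
noncomputable def auxE (l n : ℕ) : ℝ := auxJ (Polynomial.X ^ 2 * (auxW ^ n * auxU l n ^ 2))

open Polynomial in
lemma auxW_der : derivative auxW = -2 * X := by
  simp [auxW]
  norm_num

open Polynomial in
lemma auxA_succ (l n : ℕ) : auxA l (n+1) = ((l:ℝ) - n) * (l + n + 1) * auxA l n := by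
  have h := auxJ_der (auxW ^ n * (auxU l n * auxU l (n+1)))
  have e : derivative (auxW * (auxW ^ n * (auxU l n * auxU l (n+1)))) =
      auxW ^ (n+1) * auxU l (n+1) ^ 2 -
        C (((l:ℝ) - n) * (l + n + 1)) * (auxW ^ n * auxU l n ^ 2) := by
    rw [← mul_assoc, ← pow_succ', derivative_mul, derivative_mul, derivative_pow, auxU_succ, auxU_succ, auxW_der]
    simp
    linear_combination (auxW ^ n * auxU l n) * auxU_ode l n
  rw [e, auxJ_sub, auxJ_C] at h
  unfold auxA
  linarith

open Polynomial in
lemma auxE_eq (l m : ℕ) : (4 * ((l:ℝ) * (l + 1)) - 3) * auxE l (m+1) =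
    (2 * ((l:ℝ) * (l + 1)) - 1 - 2 * ((m:ℝ)+1) ^ 2) * auxA l (m+1) := by
  have h := auxJ_der (auxW ^ m * ((X * ((auxW * auxU l (m+2) - ((m:ℝ[X])+1) * X * auxU l (m+1)) ^ 2
     + ((l:ℝ[X]) * ((l:ℝ[X])+1) * auxW - ((m:ℝ[X])+1)^2) * auxU l (m+1) ^ 2))
     - (auxW * auxU l (m+1) * (auxW * auxU l (m+2) - ((m:ℝ[X])+1) * X * auxU l (m+1)) +
       X * auxW * auxU l (m+1) ^ 2)))
  set G := (X * ((auxW * auxU l (m+2) - ((m:ℝ[X])+1) * X * auxU l (m+1)) ^ 2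
     + ((l:ℝ[X]) * ((l:ℝ[X])+1) * auxW - ((m:ℝ[X])+1)^2) * auxU l (m+1) ^ 2))
     - (auxW * auxU l (m+1) * (auxW * auxU l (m+2) - ((m:ℝ[X])+1) * X * auxU l (m+1)) +
       X * auxW * auxU l (m+1) ^ 2) with hG
  have e : derivative (auxW * (auxW ^ m * G)) =
      C (2 * ((l:ℝ) * (l + 1)) - 1 - 2 * ((m:ℝ)+1) ^ 2) * (auxW ^ (m+1) * auxU l (m+1) ^ 2)
      - C (4 * ((l:ℝ) * (l + 1)) - 3) * (X ^ 2 * (auxW ^ (m+1) * auxU l (m+1) ^ 2)) := by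
    rw [← mul_assoc, ← pow_succ', derivative_mul, derivative_pow, auxW_der, hG]
    simp [auxU_succ, derivative_pow, auxW_der, C2, C3, C4]
    have o := auxU_ode l (m+1)
    push_cast at o
    have hw : auxW = 1 - X ^ 2 := rfl
    generalize hp : auxW ^ m = p
    rw [show auxW ^ (m+1) = p * auxW by rw [pow_succ, hp]]
    rw [hw] at o ⊢
    linear_combination (2 * X * (p * (1-X^2)) * ((1-X^2) * auxU l (m+2) - ((m:ℝ[X])+1) * X * auxU l (m+1)) - (p * (1-X^2)) * (1-X^2) * auxU l (m+1)) * o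
  rw [e, auxJ_sub, auxJ_C, auxJ_C] at h
  unfold auxA auxE
  linarith

open Polynomial in
lemma auxD_rec (l m : ℕ) : 4 * ((m:ℝ)+2)^2 * (auxD l (m+1) - auxA l (m+2)) =
    auxA l (m+3) + (((l:ℝ) - m - 1) * (l + m + 2))^2 * auxA l (m+1) +
    2 * (((l:ℝ) - m - 1) * (l + m + 2)) * (-auxA l (m+2) + (m+2) * (-auxA l (m+1) +
      2 * ((m:ℝ)+1) * (auxD l m - auxA l (m+1)))) := by
  have h1 := auxJ_der (auxW ^ (m+1) * (auxU l (m+1) * auxU l (m+2)))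
  have h2 := auxJ_der (auxW ^ m * (X * auxU l (m+1)^2))
  have e1 : derivative (auxW * (auxW ^ (m+1) * (auxU l (m+1) * auxU l (m+2)))) =
     auxW ^ (m+2) * auxU l (m+2) ^ 2 + auxW ^ (m+2) * auxU l (m+1) * auxU l (m+3) -
     2 * ((m:ℝ[X])+2) * X * auxW ^ (m+1) * auxU l (m+1) * auxU l (m+2) := by
    rw [← mul_assoc, ← pow_succ', derivative_mul, derivative_pow, auxW_der]
    simp [auxU_succ]
    ring
  have e2 : derivative (auxW * (auxW ^ m * (X * auxU l (m+1)^2))) =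
     auxW ^ (m+1) * auxU l (m+1) ^ 2 - 2 * ((m:ℝ[X])+1) * (1 - auxW) * auxW ^ m * auxU l (m+1) ^ 2 +
     2 * X * auxW ^ (m+1) * auxU l (m+1) * auxU l (m+2) := by
    rw [← mul_assoc, ← pow_succ', derivative_mul, derivative_pow, auxW_der]
    simp [auxU_succ, derivative_pow, C2]
    rw [show (1:ℝ[X]) - auxW = X^2 by simp [auxW]]
    ring
  have o := auxU_ode l (m+1)
  push_cast at o
  set μ : ℝ := ((l:ℝ) - m - 1) * (l + m + 2) with hμ
  have hCμ : C μ = ((l:ℝ[X]) - (m:ℝ[X]) - 1) * ((l:ℝ[X]) + (m:ℝ[X]) + 2) := by simp [hμ, C2]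
  have key : C (4 * ((m:ℝ)+2)^2) * (auxW ^ (m+1) * auxU l (m+2)^2 - auxW ^ (m+2) * auxU l (m+2) ^ 2)
    = auxW ^ (m+3) * auxU l (m+3) ^ 2 + C (μ^2) * (auxW ^ (m+1) * auxU l (m+1) ^ 2)
     + C (2 * μ) * (derivative (auxW * (auxW ^ (m+1) * (auxU l (m+1) * auxU l (m+2))))
       - auxW ^ (m+2) * auxU l (m+2) ^ 2 + C ((m:ℝ)+2) * (derivative (auxW * (auxW ^ m * (X * auxU l (m+1)^2)))
         - auxW ^ (m+1) * auxU l (m+1) ^ 2 + C (2 * ((m:ℝ)+1)) *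
           (auxW ^ m * auxU l (m+1) ^ 2 - auxW ^ (m+1) * auxU l (m+1) ^ 2))) := by
    rw [e1, e2]
    simp only [C_mul, C_pow, hCμ]
    simp [C2, C4]
    have hw : auxW = 1 - X ^ 2 := rfl
    have o' : 2 * ((m:ℝ[X]) + 2) * X * auxU l (m+2) = auxW * auxU l (m+3) + ((l:ℝ[X]) - (m:ℝ[X]) - 1) * ((l:ℝ[X]) + (m:ℝ[X]) + 2) * auxU l (m+1) := by
      linear_combination -o
    have o2 := congrArg (fun z => auxW ^ (m+1) * z ^ 2) o'
    have hX : X ^ 2 = 1 - auxW := by rw [hw]; ring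
    linear_combination o2 - 4 * ((m:ℝ[X]) + 2)^2 * auxU l (m+2)^2 * auxW ^ (m+1) * hX
  have := congrArg auxJ key
  simp only [auxJ_add, auxJ_sub, auxJ_C, h1, h2] at this
  unfold auxA auxD
  linarith

open Polynomial in
lemma auxI_rec (n : ℕ) : (2 * (n:ℝ) + 3) * auxJ (auxW ^ (n+1)) = 2 * ((n:ℝ)+1) * auxJ (auxW ^ n) := by
  have h := auxJ_der (auxW ^ n * X)
  have e : derivative (auxW * (auxW ^ n * X)) =
      C (2 * (n:ℝ) + 3) * auxW ^ (n+1) - C (2 * ((n:ℝ)+1)) * auxW ^ n := by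
    rw [← mul_assoc, ← pow_succ', derivative_mul, derivative_pow, auxW_der]
    simp [C2, C3]
    have hX : X ^ 2 = 1 - auxW := by simp [auxW]
    linear_combination (-2 * ((n:ℝ[X]) + 1) * auxW ^ n) * hX
  rw [e, auxJ_sub, auxJ_C, auxJ_C] at h
  linarith

lemma auxI_eq (l : ℕ) : auxJ (auxW ^ l) * (Nat.factorial (2 * l + 1) : ℝ) =
    2 * (2 ^ l * (Nat.factorial l : ℝ)) ^ 2 := by
  induction l with
  | zero => simp [auxJ]; norm_num
  | succ n ih =>
    have h := auxI_rec n
    rw [show 2 * (n + 1) + 1 = (2 * n + 1) + 1 + 1 by ring, Nat.factorial_succ, Nat.factorial_succ,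
      Nat.factorial_succ n]
    push_cast
    linear_combination (2 * (n:ℝ) + 2) * (Nat.factorial (2 * n + 1) : ℝ) * h +
      (2 * (n:ℝ) + 2) * (2 * ((n:ℝ)+1)) * ih

open Polynomial in
lemma auxJ_top (l m : ℕ) : auxJ (auxW ^ m * auxU l l ^ 2) = (Nat.factorial (2 * l) : ℝ) ^ 2 * auxJ (auxW ^ m) := by
  rw [auxU, auxV_top, ← C_pow, mul_comm, auxJ_C]

lemma auxA_eq (k l n : ℕ) (h : n + k = l) :
    auxA l n * ((Nat.factorial k : ℝ) * (2 * l + 1)) =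
      2 * (Nat.factorial (l + n) : ℝ) * (2 ^ l * (Nat.factorial l : ℝ)) ^ 2 := by
  induction k generalizing n with
  | zero =>
    obtain rfl : n = l := by omega
    have := auxI_eq n
    rw [Nat.factorial_succ] at this
    unfold auxA
    rw [auxJ_top, ← two_mul]
    push_cast at this ⊢
    simp only [Nat.factorial_zero]
    push_cast
    linear_combination (Nat.factorial (2 * n) : ℝ) * this
  | succ k ih =>
    have h1 := ih (n+1) (by omega)
    rw [auxA_succ, ← add_assoc, Nat.factorial_succ (l + n)] at h1
    rw [Nat.factorial_succ k]
    have hk : (l:ℝ) - n = k + 1 := by rw [← h]; push_cast; ring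
    rw [hk] at h1
    have hp : ((l:ℝ) + n + 1) ≠ 0 := by positivity
    apply mul_left_cancel₀ hp
    push_cast at h1 ⊢
    linear_combination h1

lemma auxD_eq (k l n : ℕ) (h : n + 1 + k = l) :
    2 * ((n:ℝ) + 1) * auxD l n = (2 * l + 1) * auxA l (n+1) := by
  induction k generalizing n with
  | zero =>
    obtain rfl : n + 1 = l := by omega
    have := auxI_rec n
    unfold auxA auxD
    rw [auxJ_top, auxJ_top]
    push_cast
    linear_combination -(Nat.factorial (2 * (n+1)) : ℝ)^2 * this
  | succ k ih =>
    have h1 := ih (n+1) (by omega)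
    have h2 := auxD_rec l n
    have a2 := auxA_succ l (n+1)
    have a3 := auxA_succ l (n+2)
    have hp : ((l:ℝ) - n - 1) * (l + n + 2) ≠ 0 := by
      have hk : (l:ℝ) - n - 1 = k + 1 := by rw [← h]; push_cast; ring
      rw [hk]; positivity
    have hn : (2 * ((n:ℝ) + 2)) ≠ 0 := by positivity
    apply mul_left_cancel₀ (mul_ne_zero hn hp)
    simp only [add_assoc, Nat.reduceAdd] at *
    push_cast at *
    rw [a3] at h2
    rw [a2] at h1 h2
    linear_combination 2 * ((n:ℝ) + 2) * h1 - h2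

lemma aux_iter (p : Polynomial ℝ) (k : ℕ) :
    iteratedDeriv k (fun x => p.eval x) = fun x => (Polynomial.derivative^[k] p).eval x := by
  induction k with
  | zero => simp
  | succ k ih =>
    rw [iteratedDeriv_succ, ih]
    funext x
    rw [Polynomial.deriv, Function.iterate_succ_apply']

lemma aux_legendre (l n : ℕ) (x : ℝ) : iteratedDeriv n (legendreP l) x =
    (1 / ((2 : ℝ) ^ l * (Nat.factorial l : ℝ))) * (auxU l n).eval x := by
  have h : legendreP l = fun x => (Polynomial.C (1 / ((2 : ℝ) ^ l * (Nat.factorial l : ℝ))) * auxV l l).eval x := by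
    funext x
    have := congrFun (aux_iter ((Polynomial.X ^ 2 - 1) ^ l) l) x
    simp only [Polynomial.eval_pow, Polynomial.eval_sub, Polynomial.eval_X, Polynomial.eval_one] at this
    rw [legendreP, this]
    simp [auxV]
  rw [h, aux_iter, Polynomial.iterate_derivative_C_mul]
  beta_reduce
  rw [Polynomial.eval_C_mul, auxU, auxV, auxV,
    ← Function.iterate_add_apply, add_comm l n]

lemma aux_subst (p : Polynomial ℝ) : ∫ s in (0:ℝ)..π, Real.sin s * p.eval (Real.cos s) = auxJ p := by
  have h := intervalIntegral.integral_comp_mul_deriv (a := 0) (b := π) (f := Real.cos)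
    (f' := fun s => -Real.sin s) (g := fun x => p.eval x)
    (fun x _ => Real.hasDerivAt_cos x) (by fun_prop) p.continuous
  simp only [Real.cos_zero, Real.cos_pi, Function.comp] at h
  rw [intervalIntegral.integral_symm (-1) 1] at h
  unfold auxJ
  rw [← neg_inj, ← h, ← intervalIntegral.integral_neg]
  congr 1
  funext s
  ring

/-- the integrand as a polynomial in `cos s` -/
noncomputable def auxF (l m : ℕ) : Polynomial ℝ :=
  auxW ^ m * auxU l (m+1) ^ 2 - Polynomial.C 8 * (Polynomial.X ^ 2 * (auxW ^ (m+1) * auxU l (m+1) ^ 2))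

lemma aux_integrand (l m : ℕ) (s : ℝ) (hs : s ∈ Set.Icc 0 π) :
    Real.cos (4 * s) * (1 / Real.sin s) ^ 2 * (pageY l (m+1) s) ^ 2 =
    ((1 + 2 * (l : ℝ)) * (Nat.factorial (l - (m+1)) : ℝ) / (2 * (Nat.factorial (l + (m+1)) : ℝ)))
      * (1 / ((2 : ℝ) ^ l * (Nat.factorial l : ℝ))) ^ 2 *
      (Real.sin s * (auxF l m).eval (Real.cos s)) := by
  have h0 : 0 ≤ Real.sin s := Real.sin_nonneg_of_mem_Icc hs
  have hw : 1 - Real.cos s ^ 2 = Real.sin s ^ 2 := by rw [Real.sin_sq]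
  have h4 : Real.cos (4 * s) = 1 - 8 * Real.cos s ^ 2 * Real.sin s ^ 2 := by
    rw [show 4 * s = 2 * (2 * s) by ring, Real.cos_two_mul, Real.cos_two_mul, Real.sin_sq]; ring
  have hp : ((Real.sin s ^ 2) ^ (((m+1 : ℕ) : ℝ) / 2)) = Real.sin s ^ (m+1) := by
    rw [← Real.rpow_natCast (Real.sin s) 2, ← Real.rpow_mul h0, ← Real.rpow_natCast]
    congr 1
    push_cast; ring
  unfold pageY assocLegendreP
  rw [mul_pow, Real.sq_sqrt (by positivity), mul_pow, Real.sq_sqrt h0, mul_pow, hw, hp, aux_legendre, h4]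
  have hF : (auxF l m).eval (Real.cos s) = (1 - 8 * Real.cos s ^ 2 * Real.sin s ^ 2) *
      ((Real.sin s ^ 2) ^ m * (auxU l (m+1)).eval (Real.cos s) ^ 2) := by
    simp only [auxF, auxW, Polynomial.eval_sub, Polynomial.eval_mul, Polynomial.eval_pow,
      Polynomial.eval_C, Polynomial.eval_X, Polynomial.eval_one, hw]
    ring
  rw [hF]
  rcases eq_or_ne (Real.sin s) 0 with hz | hz
  · simp [hz]
  · generalize (1 + 2 * (l : ℝ)) * (Nat.factorial (l - (m+1)) : ℝ) / (2 * (Nat.factorial (l + (m+1)) : ℝ)) = c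
    generalize 1 / ((2 : ℝ) ^ l * (Nat.factorial l : ℝ)) = d
    field_simp
    ring

/-- For integers `1 ≤ n ≤ ℓ`, the integral `∫₀^π cos(4s) csc²(s) y_{ℓ,n}(s)² ds` converges and
equals `(32n³ − 32nℓ² − 32nℓ + 16n + 8ℓ³ + 12ℓ² − 2ℓ − 3)/(2n(2ℓ−1)(2ℓ+3))`. -/
theorem integral_cos4s_cscsq_pageY (l n : ℕ) (hn1 : 1 ≤ n) (hnl : n ≤ l) :
    IntervalIntegrable (fun s => Real.cos (4 * s) * (1 / Real.sin s) ^ 2 * (pageY l n s) ^ 2)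
      MeasureTheory.volume 0 π ∧
    (∫ s in (0 : ℝ)..π, Real.cos (4 * s) * (1 / Real.sin s) ^ 2 * (pageY l n s) ^ 2) =
      (32 * (n : ℝ) ^ 3 - 32 * (n : ℝ) * (l : ℝ) ^ 2 - 32 * (n : ℝ) * (l : ℝ) + 16 * (n : ℝ) +
          8 * (l : ℝ) ^ 3 + 12 * (l : ℝ) ^ 2 - 2 * (l : ℝ) - 3) /
        (2 * (n : ℝ) * (2 * (l : ℝ) - 1) * (2 * (l : ℝ) + 3)) := by
  obtain ⟨m, rfl⟩ : ∃ m, n = m + 1 := ⟨n - 1, by omega⟩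
  have hI := fun s hs => aux_integrand l m s hs
  have hu : Set.uIcc 0 π = Set.Icc 0 π := Set.uIcc_of_le Real.pi_pos.le
  constructor
  · have hc : Continuous (fun s => ((1 + 2 * (l : ℝ)) * (Nat.factorial (l - (m+1)) : ℝ) / (2 * (Nat.factorial (l + (m+1)) : ℝ)))
      * (1 / ((2 : ℝ) ^ l * (Nat.factorial l : ℝ))) ^ 2 *
      (Real.sin s * (auxF l m).eval (Real.cos s))) := by
      have := (auxF l m).continuous.comp Real.continuous_cos
      simp only [Function.comp_def] at this
      fun_prop
    refine (hc.intervalIntegrable 0 π).congr ?_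
    intro s hs
    rw [Set.uIoc_of_le Real.pi_pos.le] at hs
    exact (hI s ⟨hs.1.le, hs.2⟩).symm
  · rw [intervalIntegral.integral_congr (fun s hs => hI s (hu ▸ hs)),
      intervalIntegral.integral_const_mul, aux_subst]
    have hJ : auxJ (auxF l m) = auxD l m - 8 * auxE l (m+1) := by
      rw [auxF, auxJ_sub, auxJ_C]; rfl
    have hE := auxE_eq l m
    have hA := auxA_eq (l - (m+1)) l (m+1) (by omega)
    have hD := auxD_eq (l - (m+1)) l m (by omega)
    have hl : (1:ℝ) ≤ l := by exact_mod_cast hn1.trans hnl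
    have h1 : (2 * (l:ℝ) - 1) ≠ 0 := by linarith
    have h3 : (2 * (l:ℝ) + 3) ≠ 0 := by positivity
    have h2 : (2 * (l:ℝ) + 1) ≠ 0 := by positivity
    have hm : ((m:ℝ) + 1) ≠ 0 := by positivity
    have hE' : auxE l (m+1) = (2 * ((l:ℝ) * (l + 1)) - 1 - 2 * ((m:ℝ)+1) ^ 2) * auxA l (m+1) /
        ((2 * (l:ℝ) - 1) * (2 * l + 3)) := by
      rw [eq_div_iff (mul_ne_zero h1 h3)]
      linear_combination hE
    have hD' : auxD l m = (2 * l + 1) * auxA l (m+1) / (2 * ((m:ℝ)+1)) := by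
      rw [eq_div_iff (by positivity)]
      linear_combination hD
    have f1 : (Nat.factorial (l - (m+1)) : ℝ) ≠ 0 := by positivity
    have f2 : (Nat.factorial (l + (m+1)) : ℝ) ≠ 0 := by positivity
    have f3 : (2 : ℝ) ^ l * (Nat.factorial l : ℝ) ≠ 0 := by positivity
    have hc : ((1 + 2 * (l : ℝ)) * (Nat.factorial (l - (m+1)) : ℝ) / (2 * (Nat.factorial (l + (m+1)) : ℝ)))
      * (1 / ((2 : ℝ) ^ l * (Nat.factorial l : ℝ))) ^ 2 * auxA l (m+1) = 1 := by
      generalize (2 : ℝ) ^ l * (Nat.factorial l : ℝ) = d at *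
      field_simp
      linear_combination hA
    generalize ((1 + 2 * (l : ℝ)) * (Nat.factorial (l - (m+1)) : ℝ) / (2 * (Nat.factorial (l + (m+1)) : ℝ)))
      * (1 / ((2 : ℝ) ^ l * (Nat.factorial l : ℝ))) ^ 2 = c at *
    rw [hJ, hE', hD']
    push_cast
    generalize auxA l (m+1) = a at *
    have : c * ((2 * l + 1) * a / (2 * ((m:ℝ)+1)) - 8 * ((2 * ((l:ℝ) * (l + 1)) - 1 - 2 * ((m:ℝ)+1) ^ 2) * a /
        ((2 * (l:ℝ) - 1) * (2 * l + 3)))) = (c * a) * ((2 * l + 1) / (2 * ((m:ℝ)+1)) - 8 * ((2 * ((l:ℝ) * (l + 1)) - 1 - 2 * ((m:ℝ)+1) ^ 2) /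
        ((2 * (l:ℝ) - 1) * (2 * l + 3)))) := by ring
    rw [this, hc]
    field_simp
    ring
end

section
/- For all integers ℓ, n with 1 ≤ n ≤ ℓ, the integral ∫₀^π s·cot(s)·csc²(s) [y_{ℓ,n}(s)]² ds converges and equals (2ℓ+1)(4n² − 4nℓ − 2n − 1) / (2n(2n−1)(2n+1)). -/
open Set Real

open Polynomial in
noncomputable def legPoly (l : ℕ) : ℝ[X] :=
  C (1 / ((2 : ℝ) ^ l * (Nat.factorial l : ℝ))) * derivative^[l] ((X ^ 2 - 1) ^ l)

open Polynomial in
noncomputable def legQ (l n : ℕ) : ℝ[X] := derivative^[n] (legPoly l)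

section helpers
open Polynomial

theorem iteratedDeriv_polyEval (p : ℝ[X]) (k : ℕ) :
    iteratedDeriv k (fun x => p.eval x) = fun x => (derivative^[k] p).eval x := by
  induction k with
  | zero => simp
  | succ k ih =>
    rw [iteratedDeriv_succ, ih, Function.iterate_succ_apply']
    funext x
    simp

theorem legendreP_eq (l : ℕ) : legendreP l = fun x => (legPoly l).eval x := by
  funext x
  have h : (fun t : ℝ => (t ^ 2 - 1) ^ l) = fun t => ((X ^ 2 - 1 : ℝ[X]) ^ l).eval t := by
    funext t; simp
  rw [legendreP, h, iteratedDeriv_polyEval, legPoly, eval_mul, eval_C]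

theorem iteratedDeriv_legendreP (l n : ℕ) :
    iteratedDeriv n (legendreP l) = fun x => (legQ l n).eval x := by
  rw [legendreP_eq, iteratedDeriv_polyEval, legQ]

theorem legQ_succ (l n : ℕ) : derivative (legQ l n) = legQ l (n + 1) := by
  rw [legQ, legQ, Function.iterate_succ_apply']

theorem base_ode (l k : ℕ) :
    (X ^ 2 - 1) * derivative^[k + 2] ((X ^ 2 - 1 : ℝ[X]) ^ l)
      + 2 * ((k : ℝ[X]) + 1 - (l : ℝ[X])) * X * derivative^[k + 1] ((X ^ 2 - 1 : ℝ[X]) ^ l)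
      + ((k : ℝ[X]) + 1) * ((k : ℝ[X]) - 2 * (l : ℝ[X])) * derivative^[k] ((X ^ 2 - 1 : ℝ[X]) ^ l) = 0 := by
  induction k with
  | zero =>
    have h1 : (X ^ 2 - 1) * derivative ((X ^ 2 - 1 : ℝ[X]) ^ l)
        = 2 * (l : ℝ[X]) * X * (X ^ 2 - 1 : ℝ[X]) ^ l := by
      cases l with
      | zero => simp
      | succ m =>
        simp only [derivative_pow_succ, derivative_sub, derivative_one]
        push_cast
        simp
        ring
    have h2 := congrArg derivative h1
    simp only [derivative_mul, derivative_sub, derivative_X_pow, derivative_one, derivative_X,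
      derivative_natCast, derivative_ofNat] at h2
    simp only [Function.iterate_succ_apply, Function.iterate_zero_apply]
    have hC : C (2 : ℝ) = 2 := map_ofNat C 2
    push_cast at h2 ⊢
    simp [hC] at h2 ⊢
    linear_combination h2
  | succ k ih =>
    have h2 := congrArg derivative ih
    simp only [derivative_mul, derivative_add, derivative_sub, derivative_X_pow, derivative_one,
      derivative_X, derivative_natCast, derivative_ofNat, derivative_zero,
      ← Function.iterate_succ_apply' derivative] at h2
    simp only [Nat.succ_eq_add_one, add_assoc] at h2
    have hC : C (2 : ℝ) = 2 := map_ofNat C 2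
    norm_num [hC] at h2
    simp only [add_assoc]
    norm_num
    linear_combination h2

theorem legQ_ode (l n : ℕ) :
    (1 - X ^ 2) * legQ l (n + 2) - 2 * ((n : ℝ[X]) + 1) * X * legQ l (n + 1)
      + ((l : ℝ[X]) - (n : ℝ[X])) * ((l : ℝ[X]) + (n : ℝ[X]) + 1) * legQ l n = 0 := by
  have h := base_ode l (n + l)
  simp only [legQ, legPoly, iterate_derivative_C_mul, ← Function.iterate_add_apply]
  rw [show n + 2 + l = n + l + 2 by ring, show n + 1 + l = n + l + 1 by ring]
  push_cast at h
  linear_combination (-C (1 / ((2 : ℝ) ^ l * (Nat.factorial l : ℝ)))) * h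

theorem legQ_top (l : ℕ) :
    legQ l l = C ((Nat.factorial (2 * l) : ℝ) / ((2 : ℝ) ^ l * (Nat.factorial l : ℝ))) := by
  have hm : (X ^ 2 - 1 : ℝ[X]).Monic := by
    simpa using monic_X_pow_sub_C (1 : ℝ) (two_ne_zero)
  have hd0 : (X ^ 2 - 1 : ℝ[X]).natDegree = 2 := by
    simpa using natDegree_X_pow_sub_C (n := 2) (r := (1 : ℝ))
  have hd : ((X ^ 2 - 1 : ℝ[X]) ^ l).natDegree = 2 * l := by
    rw [hm.natDegree_pow, hd0]; ring
  have hc : ((X ^ 2 - 1 : ℝ[X]) ^ l).coeff (2 * l) = 1 := by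
    rw [← hd]; exact (hm.pow l)
  have h0 : (derivative^[2 * l] ((X ^ 2 - 1 : ℝ[X]) ^ l)).natDegree = 0 := by
    have := natDegree_iterate_derivative ((X ^ 2 - 1 : ℝ[X]) ^ l) (2 * l)
    omega
  have h1 : derivative^[2 * l] ((X ^ 2 - 1 : ℝ[X]) ^ l) = C (Nat.factorial (2 * l) : ℝ) := by
    rw [eq_C_of_natDegree_eq_zero h0, coeff_iterate_derivative, zero_add, hc,
      Nat.descFactorial_self]
    simp
  rw [legQ, legPoly, iterate_derivative_C_mul, ← Function.iterate_add_apply, ← two_mul, h1, ← C_mul]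
  congr 1
  ring

theorem cont_LF (p : ℝ[X]) : Continuous (fun s : ℝ => p.eval (Real.cos s) * Real.sin s) := by
  have := p.continuous
  fun_prop

noncomputable def LF : ℝ[X] →ₗ[ℝ] ℝ where
  toFun p := ∫ s in (0 : ℝ)..Real.pi, p.eval (Real.cos s) * Real.sin s
  map_add' p q := by
    rw [← intervalIntegral.integral_add ((cont_LF p).intervalIntegrable _ _)
      ((cont_LF q).intervalIntegrable _ _)]
    simp only [eval_add, add_mul]
  map_smul' a p := by
    simp only [RingHom.id_apply, smul_eq_mul]
    rw [← intervalIntegral.integral_const_mul]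
    simp only [eval_smul, smul_eq_mul, mul_assoc]

theorem LF_apply (p : ℝ[X]) :
    LF p = ∫ s in (0 : ℝ)..Real.pi, p.eval (Real.cos s) * Real.sin s := rfl

theorem LF_C_mul (a : ℝ) (p : ℝ[X]) : LF (C a * p) = a * LF p := by
  rw [← smul_eq_C_mul, map_smul, smul_eq_mul]

theorem LF_derivative (p : ℝ[X]) : LF (derivative p) = p.eval 1 - p.eval (-1) := by
  rw [LF_apply, intervalIntegral.integral_eq_sub_of_hasDerivAt
    (f := fun s => - p.eval (Real.cos s))]
  · simp; ring
  · intro s _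
    have h := ((p.hasDerivAt (Real.cos s)).comp s (Real.hasDerivAt_cos s)).neg
    convert! h using 1
    ring
  · exact (cont_LF _).intervalIntegrable _ _

theorem LF_derivative_u (k : ℕ) (p : ℝ[X]) :
    LF (derivative ((1 - X ^ 2) ^ (k + 1) * p)) = 0 := by
  rw [LF_derivative]; simp

theorem der_u (k : ℕ) : derivative ((1 - X ^ 2 : ℝ[X]) ^ (k + 1))
    = -2 * ((k : ℝ[X]) + 1) * X * (1 - X ^ 2) ^ k := by
  simp [derivative_pow_succ]
  ring

theorem LF_u_succ (k : ℕ) :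
    (2 * (k : ℝ) + 3) * LF ((1 - X ^ 2) ^ (k + 1)) = (2 * k + 2) * LF ((1 - X ^ 2) ^ k) := by
  have h := LF_derivative_u k X
  have e : derivative ((1 - X ^ 2 : ℝ[X]) ^ (k + 1) * X)
      = C (2 * (k : ℝ) + 3) * (1 - X ^ 2) ^ (k + 1) - C (2 * (k : ℝ) + 2) * (1 - X ^ 2) ^ k := by
    rw [derivative_mul, der_u, derivative_X]
    simp only [C_add, C_mul, C_ofNat, map_natCast]
    ring
  rw [e, map_sub, LF_C_mul, LF_C_mul] at h
  linarith

theorem LF_one : LF 1 = 2 := by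
  rw [LF_apply]; simp; norm_num

theorem LF_u (k : ℕ) :
    LF ((1 - X ^ 2) ^ k) * (Nat.factorial (2 * k + 1) : ℝ)
      = 2 * ((2 : ℝ) ^ k * (Nat.factorial k : ℝ)) ^ 2 := by
  induction k with
  | zero => simp [LF_one]
  | succ k ih =>
    have h := LF_u_succ k
    rw [show 2 * (k + 1) + 1 = (2 * k + 1) + 1 + 1 by ring, Nat.factorial_succ (2 * k + 1 + 1),
      Nat.factorial_succ (2 * k + 1), Nat.factorial_succ k]
    push_cast
    rw [pow_succ (2 : ℝ) k]
    linear_combination (2 * k + 2) * (Nat.factorial (2 * k + 1) : ℝ) * h + (2 * k + 2) ^ 2 * ih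

theorem LF_orth (l : ℕ) : ∀ (d n : ℕ) (r : ℝ[X]), n + d = l → derivative^[d] r = 0 →
    LF ((1 - X ^ 2) ^ n * legQ l n * r) = 0 := by
  intro d
  induction d with
  | zero =>
    intro n r _ hr
    have : r = 0 := by simpa using hr
    simp [this]
  | succ d ih =>
    intro n r hn hr
    have h1 := ih (n + 1) (derivative r) (by omega) (by rwa [← Function.iterate_succ_apply])
    have h2 := LF_derivative_u n (legQ l (n + 1) * r)
    have e : C (((l : ℝ) - n) * (l + n + 1)) * ((1 - X ^ 2) ^ n * legQ l n * r)
        = (1 - X ^ 2) ^ (n + 1) * legQ l (n + 1) * derivative r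
          - derivative ((1 - X ^ 2) ^ (n + 1) * (legQ l (n + 1) * r)) := by
      rw [derivative_mul, derivative_mul, der_u, legQ_succ]
      simp only [C_add, C_mul, C_sub, C_1, map_natCast]
      linear_combination (1 - X ^ 2) ^ n * r * legQ_ode l n
    have h3 := congrArg LF e
    rw [LF_C_mul, map_sub, h1, h2, sub_zero] at h3
    have hl : (l : ℝ) = n + d + 1 := by rw [← hn]; push_cast; ring
    rcases mul_eq_zero.1 h3 with h | h
    · exfalso
      have : ((l : ℝ) - n) * (l + n + 1) > 0 := by
        rw [hl, show (n : ℝ) + d + 1 - n = d + 1 by ring]; positivity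
      linarith
    · exact h

theorem A_rec (l n : ℕ) : ((l : ℝ) - n) * (l + n + 1) * LF ((1 - X ^ 2) ^ n * legQ l n ^ 2)
    = LF ((1 - X ^ 2) ^ (n + 1) * legQ l (n + 1) ^ 2) := by
  have h2 := LF_derivative_u n (legQ l (n + 1) * legQ l n)
  have e : C (((l : ℝ) - n) * (l + n + 1)) * ((1 - X ^ 2) ^ n * legQ l n ^ 2)
      = (1 - X ^ 2) ^ (n + 1) * legQ l (n + 1) ^ 2
        - derivative ((1 - X ^ 2) ^ (n + 1) * (legQ l (n + 1) * legQ l n)) := by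
    rw [derivative_mul, derivative_mul, der_u, legQ_succ, legQ_succ]
    simp only [C_add, C_mul, C_sub, C_1, map_natCast]
    linear_combination (1 - X ^ 2) ^ n * legQ l n * legQ_ode l n
  rw [← LF_C_mul, e, map_sub, h2, sub_zero]

theorem A_val (l : ℕ) : ∀ d n : ℕ, n + d = l →
    LF ((1 - X ^ 2) ^ n * legQ l n ^ 2) * ((2 * (l : ℝ) + 1) * (Nat.factorial d : ℝ))
      = 2 * (Nat.factorial (l + n) : ℝ) := by
  intro d
  induction d with
  | zero =>
    intro n hn
    obtain rfl : n = l := by simpa using hn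
    rw [legQ_top, ← C_pow, mul_comm _ (C _), LF_C_mul]
    have h := LF_u n
    rw [Nat.factorial_succ] at h
    push_cast at h
    have hp : (0 : ℝ) < 2 ^ n * (Nat.factorial n : ℝ) := by positivity
    have hq : (0 : ℝ) < (Nat.factorial (2 * n) : ℝ) := by positivity
    rw [← two_mul]
    simp only [Nat.factorial_zero, Nat.cast_one, mul_one]
    generalize (2 : ℝ) ^ n * (Nat.factorial n : ℝ) = P at *
    field_simp
    linear_combination h
  | succ d ih =>
    intro n hn
    have h := ih (n + 1) (by omega)
    have hr := A_rec l n
    have hl : (l : ℝ) - n = d + 1 := by rw [← hn]; push_cast; ring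
    rw [hl] at hr
    rw [← hr, ← add_assoc, Nat.factorial_succ (l + n)] at h
    rw [Nat.factorial_succ d]
    push_cast at h ⊢
    have hp : (0 : ℝ) < (l : ℝ) + n + 1 := by positivity
    apply mul_left_cancel₀ hp.ne'
    linear_combination h

theorem legQ_big (l : ℕ) : legQ l (l + 1) = 0 := by
  rw [← legQ_succ, legQ_top, derivative_C]

theorem B_rec (l d m : ℕ) (h : m + 1 + d = l) :
    ((m : ℝ) + 1) * (((l : ℝ) - (m + 1)) * (l + (m + 1) + 1)) * LF ((1 - X ^ 2) ^ m * legQ l (m + 1) ^ 2)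
    = ((m : ℝ) + 2) * LF ((1 - X ^ 2) ^ (m + 1) * legQ l (m + 2) ^ 2) := by
  have h2 := LF_derivative_u m (legQ l (m + 2) * legQ l (m + 1))
  have h3 := LF_orth l d (m + 1) (legQ l (m + 3)) h (by
    rw [legQ, ← Function.iterate_add_apply, show d + (m + 3) = 1 + (l + 1) by omega,
      Function.iterate_add_apply]
    have := legQ_big l
    rw [legQ] at this
    rw [this]; simp)
  have ho := legQ_ode l (m + 1)
  push_cast at ho
  rw [show m + 1 + 2 = m + 3 by ring, show m + 1 + 1 = m + 2 by ring] at ho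
  have e : C (((m : ℝ) + 1) * (((l : ℝ) - (m + 1)) * (l + (m + 1) + 1)))
        * ((1 - X ^ 2) ^ m * legQ l (m + 1) ^ 2)
      = C ((m : ℝ) + 2) * ((1 - X ^ 2) ^ (m + 1) * legQ l (m + 2) ^ 2)
        - C ((m : ℝ) + 2) * derivative ((1 - X ^ 2) ^ (m + 1) * (legQ l (m + 2) * legQ l (m + 1)))
        + (1 - X ^ 2) ^ (m + 1) * legQ l (m + 1) * legQ l (m + 3) := by
    rw [derivative_mul, derivative_mul, der_u, legQ_succ, legQ_succ]
    simp only [C_add, C_mul, C_sub, C_1, map_natCast, C_ofNat]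
    linear_combination ((m : ℝ[X]) + 1) * (1 - X ^ 2) ^ m * legQ l (m + 1) * ho
  rw [← LF_C_mul, e, map_add, map_sub, LF_C_mul, LF_C_mul, h2, h3]
  ring

theorem B_val (l : ℕ) : ∀ d m : ℕ, m + 1 + d = l →
    LF ((1 - X ^ 2) ^ m * legQ l (m + 1) ^ 2) * (((m : ℝ) + 1) * (Nat.factorial d : ℝ))
      = (Nat.factorial (l + (m + 1)) : ℝ) := by
  intro d
  induction d with
  | zero =>
    intro m hn
    obtain rfl : m + 1 = l := by simpa using hn
    rw [legQ_top, ← C_pow, mul_comm _ (C _), LF_C_mul]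
    have h := LF_u m
    rw [← two_mul, show 2 * (m + 1) = 2 * m + 1 + 1 by ring, Nat.factorial_succ (2 * m + 1),
      Nat.factorial_succ m, pow_succ (2 : ℝ) m]
    have hp : (0 : ℝ) < 2 ^ m * (Nat.factorial m : ℝ) := by positivity
    have hq : (0 : ℝ) < (Nat.factorial (2 * m + 1) : ℝ) := by positivity
    push_cast
    rw [show (2 : ℝ) ^ m * 2 * (((m : ℝ) + 1) * (Nat.factorial m : ℝ))
      = (2 ^ m * (Nat.factorial m : ℝ)) * (2 * ((m : ℝ) + 1)) by ring]
    simp only [Nat.factorial_zero, Nat.cast_one, mul_one]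
    generalize (2 : ℝ) ^ m * (Nat.factorial m : ℝ) = P at *
    have hm : (0 : ℝ) < (m : ℝ) + 1 := by positivity
    field_simp
    linear_combination (2 * ((m : ℝ) + 1)) * h
  | succ d ih =>
    intro m hn
    have h := ih (m + 1) (by omega)
    have hr := B_rec l (d + 1) m hn
    have hl : (l : ℝ) - (m + 1) = d + 1 := by rw [← hn]; push_cast; ring
    rw [hl] at hr
    rw [show m + 1 + 1 = m + 2 by ring] at h
    rw [show l + (m + 2) = l + (m + 1) + 1 by ring, Nat.factorial_succ (l + (m + 1))] at h
    rw [Nat.factorial_succ d]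
    push_cast at h ⊢
    have hp : (0 : ℝ) < (l : ℝ) + (m + 1) + 1 := by positivity
    apply mul_left_cancel₀ hp.ne'
    linear_combination h + (Nat.factorial d : ℝ) * hr

/-- The hypervirial identity. -/
theorem hasDeriv_F (l m : ℕ) (s : ℝ) :
    HasDerivAt (fun s => s * Real.sin s ^ (2 * m + 1) *
        ((((m : ℝ) + 3 / 2) * Real.cos s * (legQ l (m + 1)).eval (Real.cos s)
          - Real.sin s ^ 2 * (legQ l (m + 2)).eval (Real.cos s)) ^ 2
        - (legQ l (m + 1)).eval (Real.cos s) ^ 2 *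
          ((((m : ℝ) + 1) ^ 2 - 1 / 4) - ((l : ℝ) + 1 / 2) ^ 2 * Real.sin s ^ 2))
      - Real.sin s ^ (2 * m + 2) * (legQ l (m + 1)).eval (Real.cos s) *
        (((m : ℝ) + 3 / 2) * Real.cos s * (legQ l (m + 1)).eval (Real.cos s)
          - Real.sin s ^ 2 * (legQ l (m + 2)).eval (Real.cos s)))
    (2 * (((m : ℝ) + 1) ^ 2 - 1 / 4) *
        (s * Real.cos s * Real.sin s ^ (2 * m) * (legQ l (m + 1)).eval (Real.cos s) ^ 2)
      - 2 * Real.sin s ^ (2 * m + 1) * (legQ l (m + 1)).eval (Real.cos s) ^ 2 *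
        ((((m : ℝ) + 1) ^ 2 - 1 / 4) - ((l : ℝ) + 1 / 2) ^ 2 * Real.sin s ^ 2)) s := by
  have ho := congrArg (eval (Real.cos s)) (legQ_ode l (m + 1))
  simp only [eval_add, eval_sub, eval_mul, eval_one, eval_pow, eval_X, eval_natCast, eval_ofNat,
    eval_zero] at ho
  push_cast at ho
  rw [show m + 1 + 2 = m + 3 by ring, show m + 1 + 1 = m + 2 by ring] at ho
  have hq1 := ((legQ l (m + 1)).hasDerivAt (Real.cos s)).comp s (Real.hasDerivAt_cos s)
  have hq2 := ((legQ l (m + 2)).hasDerivAt (Real.cos s)).comp s (Real.hasDerivAt_cos s)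
  rw [legQ_succ] at hq1 hq2
  have hs := Real.hasDerivAt_sin s
  have hc := Real.hasDerivAt_cos s
  have hid := hasDerivAt_id s
  have hb := ((hc.const_mul ((m : ℝ) + 3 / 2)).mul hq1).sub ((hs.pow 2).mul hq2)
  have hF := ((hid.mul (hs.pow (2 * m + 1))).mul ((hb.pow 2).sub ((hq1.pow 2).mul
    (((hs.pow 2).const_mul (((l : ℝ) + 1 / 2) ^ 2)).const_sub (((m : ℝ) + 1) ^ 2 - 1 / 4))))).sub
    (((hs.pow (2 * m + 2)).mul hq1).mul hb)
  convert! hF using 1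
  have hs2 : Real.sin s ^ 2 = 1 - Real.cos s ^ 2 := by
    have := Real.sin_sq_add_cos_sq s; linarith
  simp only [Function.comp, Pi.mul_apply, Pi.pow_apply, id, Pi.sub_apply, Nat.add_sub_cancel]
  rw [show 2 * m + 2 - 1 = 2 * m + 1 by omega]
  rw [← hs2] at ho
  push_cast
  generalize (legQ l (m + 1)).eval (Real.cos s) = q at *
  generalize (legQ l (m + 2)).eval (Real.cos s) = p at *
  generalize (legQ l (m + 3)).eval (Real.cos s) = r at *
  generalize Real.sin s = S at *
  generalize Real.cos s = c at *
  simp only [pow_succ S (2 * m), show S ^ (2 * m + 2) = S ^ (2 * m) * S ^ 2 by ring]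
  generalize S ^ (2 * m) = T at *
  linear_combination (-(2 * s * T * S ^ 2 * (((m : ℝ) + 3 / 2) * c * q - S ^ 2 * p)) + T * S ^ 3 * q)
      * ho - T * (((m : ℝ) + 1) ^ 2 - 1 / 4) *
        (-2 * s * S ^ 2 * p * q + (2 * m + 3) * s * c * q ^ 2 - S * q ^ 2) * hs2

theorem cont_main (l m : ℕ) : Continuous (fun s : ℝ =>
    s * Real.cos s * Real.sin s ^ (2 * m) * ((legQ l (m + 1)).eval (Real.cos s)) ^ 2) := by
  have := (legQ l (m + 1)).continuous
  fun_prop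

theorem main_rel (l m : ℕ) :
    (((m : ℝ) + 1) ^ 2 - 1 / 4) * (∫ s in (0 : ℝ)..Real.pi,
      s * Real.cos s * Real.sin s ^ (2 * m) * ((legQ l (m + 1)).eval (Real.cos s)) ^ 2)
    = (((m : ℝ) + 1) ^ 2 - 1 / 4) * LF ((1 - X ^ 2) ^ m * legQ l (m + 1) ^ 2)
      - ((l : ℝ) + 1 / 2) ^ 2 * LF ((1 - X ^ 2) ^ (m + 1) * legQ l (m + 1) ^ 2) := by
  have hA := LF_apply ((1 - X ^ 2) ^ (m + 1) * legQ l (m + 1) ^ 2)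
  have hB := LF_apply ((1 - X ^ 2) ^ m * legQ l (m + 1) ^ 2)
  have cA := (cont_LF ((1 - X ^ 2) ^ (m + 1) * legQ l (m + 1) ^ 2)).intervalIntegrable
    (μ := MeasureTheory.volume) 0 Real.pi
  have cB := (cont_LF ((1 - X ^ 2) ^ m * legQ l (m + 1) ^ 2)).intervalIntegrable
    (μ := MeasureTheory.volume) 0 Real.pi
  have cI := (cont_main l m).intervalIntegrable (μ := MeasureTheory.volume) 0 Real.pi
  have hc : Continuous (fun s : ℝ => 2 * (((m : ℝ) + 1) ^ 2 - 1 / 4) *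
        (s * Real.cos s * Real.sin s ^ (2 * m) * (legQ l (m + 1)).eval (Real.cos s) ^ 2)
      - 2 * Real.sin s ^ (2 * m + 1) * (legQ l (m + 1)).eval (Real.cos s) ^ 2 *
        ((((m : ℝ) + 1) ^ 2 - 1 / 4) - ((l : ℝ) + 1 / 2) ^ 2 * Real.sin s ^ 2)) := by
    have := (legQ l (m + 1)).continuous
    fun_prop
  have h := intervalIntegral.integral_eq_sub_of_hasDerivAt
    (fun s _ => hasDeriv_F l m s) (hc.intervalIntegrable 0 Real.pi)
  have e : ∀ s : ℝ, 2 * (((m : ℝ) + 1) ^ 2 - 1 / 4) *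
        (s * Real.cos s * Real.sin s ^ (2 * m) * (legQ l (m + 1)).eval (Real.cos s) ^ 2)
      - 2 * Real.sin s ^ (2 * m + 1) * (legQ l (m + 1)).eval (Real.cos s) ^ 2 *
        ((((m : ℝ) + 1) ^ 2 - 1 / 4) - ((l : ℝ) + 1 / 2) ^ 2 * Real.sin s ^ 2)
      = 2 * (((m : ℝ) + 1) ^ 2 - 1 / 4) *
        (s * Real.cos s * Real.sin s ^ (2 * m) * (legQ l (m + 1)).eval (Real.cos s) ^ 2)
      - 2 * (((m : ℝ) + 1) ^ 2 - 1 / 4) *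
        (((1 - X ^ 2) ^ m * legQ l (m + 1) ^ 2).eval (Real.cos s) * Real.sin s)
      + 2 * ((l : ℝ) + 1 / 2) ^ 2 *
        (((1 - X ^ 2) ^ (m + 1) * legQ l (m + 1) ^ 2).eval (Real.cos s) * Real.sin s) := by
    intro s
    simp only [eval_mul, eval_pow, eval_sub, eval_one, eval_X, ← Real.sin_sq, ← pow_mul]
    ring
  simp only [e] at h
  rw [intervalIntegral.integral_add ((cI.const_mul _).sub (cB.const_mul _)) (cA.const_mul _),
    intervalIntegral.integral_sub (cI.const_mul _) (cB.const_mul _),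
    intervalIntegral.integral_const_mul, intervalIntegral.integral_const_mul,
    intervalIntegral.integral_const_mul, ← hA, ← hB] at h
  simp at h
  linarith

end helpers

/-- For integers `1 ≤ n ≤ ℓ`, the integral `∫₀^π s·cot(s)·csc²(s) y_{ℓ,n}(s)² ds` converges and
equals `(2ℓ+1)(4n² − 4nℓ − 2n − 1)/(2n(2n−1)(2n+1))`. -/
theorem integral_s_cot_cscsq_pageY (l n : ℕ) (hn1 : 1 ≤ n) (hnl : n ≤ l) :
    IntervalIntegrable
      (fun s => s * (Real.cos s / Real.sin s) * (1 / Real.sin s) ^ 2 * (pageY l n s) ^ 2)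
      MeasureTheory.volume 0 π ∧
    (∫ s in (0 : ℝ)..π,
        s * (Real.cos s / Real.sin s) * (1 / Real.sin s) ^ 2 * (pageY l n s) ^ 2) =
      (2 * (l : ℝ) + 1) * (4 * (n : ℝ) ^ 2 - 4 * (n : ℝ) * (l : ℝ) - 2 * (n : ℝ) - 1) /
        (2 * (n : ℝ) * (2 * (n : ℝ) - 1) * (2 * (n : ℝ) + 1)) := by
  obtain ⟨m, rfl⟩ : ∃ m, n = m + 1 := ⟨n - 1, by omega⟩
  obtain ⟨d, hd⟩ : ∃ d, m + 1 + d = l := ⟨l - (m + 1), by omega⟩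
  have hcont := cont_main l m
  have hEq : EqOn (fun s => ((1 + 2 * (l : ℝ)) * (Nat.factorial d : ℝ) /
        (2 * (Nat.factorial (l + (m + 1)) : ℝ))) *
        (s * Real.cos s * Real.sin s ^ (2 * m) * ((legQ l (m + 1)).eval (Real.cos s)) ^ 2))
      (fun s => s * (Real.cos s / Real.sin s) * (1 / Real.sin s) ^ 2 * (pageY l (m + 1) s) ^ 2)
      (uIoo 0 π) := by
    intro s hs
    rw [uIoo_of_le Real.pi_pos.le] at hs
    have hsin : 0 < Real.sin s := Real.sin_pos_of_mem_Ioo hs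
    have hy : (pageY l (m + 1) s) ^ 2 = ((1 + 2 * (l : ℝ)) * (Nat.factorial d : ℝ) /
        (2 * (Nat.factorial (l + (m + 1)) : ℝ))) *
        (Real.sin s * (Real.sin s ^ (2 * m + 2) * ((legQ l (m + 1)).eval (Real.cos s)) ^ 2)) := by
      have hr : ((1 - Real.cos s ^ 2) ^ (((m + 1 : ℕ) : ℝ) / 2)) ^ 2 = Real.sin s ^ (2 * m + 2) := by
        rw [← Real.sin_sq, ← Real.rpow_mul_natCast (sq_nonneg _)]
        rw [show ((m + 1 : ℕ) : ℝ) / 2 * ((2 : ℕ) : ℝ) = ((m + 1 : ℕ) : ℝ) by push_cast; ring,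
          Real.rpow_natCast, ← pow_mul]
        congr 1
      rw [pageY, assocLegendreP, iteratedDeriv_legendreP, mul_pow, mul_pow, mul_pow, hr,
        Real.sq_sqrt hsin.le, Real.sq_sqrt (by positivity),
        show l - (m + 1) = d by omega]
    simp only [hy]
    field_simp
    ring
  have hI : IntervalIntegrable (fun s => ((1 + 2 * (l : ℝ)) * (Nat.factorial d : ℝ) /
        (2 * (Nat.factorial (l + (m + 1)) : ℝ))) *
        (s * Real.cos s * Real.sin s ^ (2 * m) * ((legQ l (m + 1)).eval (Real.cos s)) ^ 2))
        MeasureTheory.volume 0 π := (hcont.intervalIntegrable _ _).const_mul _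
  refine ⟨hI.congr_uIoo hEq, ?_⟩
  rw [← intervalIntegral.integral_congr_uIoo hEq, intervalIntegral.integral_const_mul]
  have h := main_rel l m
  have hA := A_val l d (m + 1) hd
  have hB := B_val l d m hd
  generalize (∫ s in (0 : ℝ)..π,
    s * Real.cos s * Real.sin s ^ (2 * m) * ((legQ l (m + 1)).eval (Real.cos s)) ^ 2) = I at *
  have hf1 : (0 : ℝ) < (Nat.factorial d : ℝ) := by positivity
  have hf2 : (0 : ℝ) < (Nat.factorial (l + (m + 1)) : ℝ) := by positivity
  generalize (Nat.factorial d : ℝ) = D at *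
  generalize (Nat.factorial (l + (m + 1)) : ℝ) = E at *
  push_cast
  have hm : (0 : ℝ) < (m : ℝ) + 1 := by positivity
  have h1 : (0 : ℝ) < 2 * ((m : ℝ) + 1) - 1 := by
    have : (0 : ℝ) ≤ m := by positivity
    linarith
  have h2 : (0 : ℝ) < 2 * ((m : ℝ) + 1) + 1 := by positivity
  have hl : (0 : ℝ) < 2 * (l : ℝ) + 1 := by positivity
  have eA : LF ((1 - Polynomial.X ^ 2) ^ (m + 1) * legQ l (m + 1) ^ 2) = 2 * E / ((2 * l + 1) * D) := by
    rw [eq_div_iff (by positivity)]; exact hA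
  have eB : LF ((1 - Polynomial.X ^ 2) ^ m * legQ l (m + 1) ^ 2) = E / (((m : ℝ) + 1) * D) := by
    rw [eq_div_iff (by positivity)]; exact hB
  rw [eA, eB] at h
  have eI : I = (E / (((m : ℝ) + 1) * D)) - ((l : ℝ) + 1 / 2) ^ 2 * (2 * E / ((2 * l + 1) * D)) * 4
      / ((2 * (m : ℝ) + 1) * (2 * ((m : ℝ) + 1) + 1)) := by
    have ha : ((m : ℝ) + 1) ^ 2 - 1 / 4 = (2 * (m : ℝ) + 1) * (2 * ((m : ℝ) + 1) + 1) / 4 := by ring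
    rw [ha] at h
    have ha0 : (2 * (m : ℝ) + 1) * (2 * ((m : ℝ) + 1) + 1) / 4 ≠ 0 := by positivity
    apply mul_left_cancel₀ ha0
    rw [h]
    field_simp
  rw [eI, show 2 * ((m : ℝ) + 1) - 1 = 2 * (m : ℝ) + 1 by ring]
  field_simp
  ring
end
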